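/- arXiv:1405.5400 — 5 statements merged into one kernel-verified Lean document; each statement's English description precedes it below -/
import Mathlib

section
/- Let φ : X → X' be a (λ,K)-quasi-isometric embedding between geodesic metric spaces. If X' is polygon hyperbolic, then X is polygon hyperbolic. -/
/-- `ξ` is a geodesic defined on the interval `[0, s]`. -/
def IsGeodesicOn {X : Type*} [MetricSpace X] (ξ : ℝ → X) (s : ℝ) : Prop :=
  0 ≤ s ∧ ∀ a ∈ Set.Icc (0:ℝ) s, ∀ b ∈ Set.Icc (0:ℝ) s, dist (ξ a) (ξ b) = |a - b|

/-- `X` is a geodesic metric space: any two points are joined by a geodesic. -/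
def IsGeodesicSpace (X : Type*) [MetricSpace X] : Prop :=
  ∀ x y : X, ∃ (s : ℝ) (ξ : ℝ → X), IsGeodesicOn ξ s ∧ ξ 0 = x ∧ ξ s = y
/-- A geodesic polygon `[[ξ₀, …, ξₙ]]` (an `(n+1)`-gon, `n ≥ 1`): a closed cycle of
`n + 1` geodesics. -/
structure GeodesicPolygon (X : Type*) [MetricSpace X] where
  n : ℕ
  one_le_n : 1 ≤ n
  s : ℕ → ℝ
  ξ : ℕ → ℝ → X
  geodesic : ∀ i ≤ n, IsGeodesicOn (ξ i) (s i)
  chain : ∀ i < n, ξ i (s i) = ξ (i + 1) 0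
  closed : ξ n (s n) = ξ 0 0

/-- The polygon is `δ`-thin: the image of the last side `ξₙ` is contained in the closed
`δ`-neighbourhood of the union of the images of `ξ₀, …, ξₙ₋₁`. -/
def GeodesicPolygon.Thin {X : Type*} [MetricSpace X] (P : GeodesicPolygon X) (δ : ℝ) : Prop :=
  ∀ t ∈ Set.Icc (0:ℝ) (P.s P.n), ∃ j < P.n, ∃ u ∈ Set.Icc (0:ℝ) (P.s j),
    dist (P.ξ P.n t) (P.ξ j u) ≤ δ

/-- `X` is polygon hyperbolic if some `δ ≥ 0` makes every geodesic polygon `δ`-thin. -/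
def PolygonHyperbolic (X : Type*) [MetricSpace X] : Prop :=
  ∃ δ : ℝ, 0 ≤ δ ∧ ∀ P : GeodesicPolygon X, P.Thin δ

theorem IsGeodesicOn.reverse {X : Type*} [MetricSpace X] {ξ : ℝ → X} {s : ℝ}
    (h : IsGeodesicOn ξ s) : IsGeodesicOn (fun u => ξ (s - u)) s := by
  refine ⟨h.1, fun a ha b hb => ?_⟩
  rw [h.2 _ ⟨by linarith [ha.2], by linarith [ha.1]⟩ _ ⟨by linarith [hb.2], by linarith [hb.1]⟩,
    abs_sub_comm]
  congr 1
  ring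

/-- In a polygon hyperbolic space, a geodesic closing up a coarse chain of points stays close to
the points of the chain. -/
theorem exists_dist_le_of_chain {X : Type*} [MetricSpace X] (hX : IsGeodesicSpace X) {δ : ℝ}
    (hδ : ∀ P : GeodesicPolygon X, P.Thin δ) {C : ℝ} {m : ℕ} (hm : 1 ≤ m) (z : ℕ → X)
    (hz : ∀ k < m, dist (z k) (z (k + 1)) ≤ C) {γ : ℝ → X} {L : ℝ} (hγ : IsGeodesicOn γ L)
    (h0 : γ 0 = z m) (hL : γ L = z 0) {u : ℝ} (hu : u ∈ Set.Icc 0 L) :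
    ∃ k < m, dist (γ u) (z k) ≤ δ + C := by
  choose s ξ hξ hξ0 hξs using fun k => hX (z k) (z (k + 1))
  let P : GeodesicPolygon X :=
    { n := m
      one_le_n := hm
      s := fun i => if i < m then s i else L
      ξ := fun i => if i < m then ξ i else γ
      geodesic := by
        intro i _
        by_cases hi : i < m
        · simpa [hi] using hξ i
        · simpa [hi] using hγ
      chain := by
        intro i hi
        by_cases hi' : i + 1 < m
        · simp [hi, hi', hξ0, hξs]
        · have : i + 1 = m := by omega
          simp [hi, hξs, h0, this]
      closed := by
        have : 0 < m := hm
        simp [this, hL, hξ0] }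
  obtain ⟨k, hk, v, hv, hd⟩ := hδ P u (by simpa [P] using hu)
  have hk : k < m := hk
  simp only [P, hk, if_true, lt_irrefl, if_false] at hv hd
  refine ⟨k, hk, (dist_triangle _ (ξ k v) _).trans (add_le_add hd ?_)⟩
  have h0s : (0 : ℝ) ∈ Set.Icc 0 (s k) := ⟨le_rfl, (hξ k).1⟩
  have h1 := (hξ k).2 v hv 0 h0s
  have h2 := (hξ k).2 0 h0s (s k) ⟨(hξ k).1, le_rfl⟩
  rw [hξ0] at h1 h2
  rw [hξs] at h2
  rw [h1, sub_zero, abs_of_nonneg hv.1]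
  refine hv.2.trans (le_trans ?_ (hz k hk))
  rw [h2, zero_sub, abs_neg]
  exact le_abs_self _

/-- A concatenation of geodesics can be subdivided into a chain with steps of length at most
one. -/
theorem exists_chain_of_geodesics {X : Type*} [MetricSpace X] {n : ℕ} (hn : 1 ≤ n) (s : ℕ → ℝ)
    (ξ : ℕ → ℝ → X) (hξ : ∀ i < n, IsGeodesicOn (ξ i) (s i))
    (hc : ∀ i < n, ξ i (s i) = ξ (i + 1) 0) :
    ∃ (m : ℕ) (z : ℕ → X), 1 ≤ m ∧ z 0 = ξ 0 0 ∧ z m = ξ n 0 ∧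
      (∀ k < m, dist (z k) (z (k + 1)) ≤ 1) ∧
      ∀ k < m, ∃ j < n, ∃ u ∈ Set.Icc (0 : ℝ) (s j), z k = ξ j u := by
  obtain ⟨N, hN⟩ := exists_nat_ge (1 + ∑ i ∈ Finset.range n, s i)
  have hs : ∀ i < n, 0 ≤ s i := fun i hi => (hξ i hi).1
  have hsum : 0 ≤ ∑ i ∈ Finset.range n, s i :=
    Finset.sum_nonneg fun i hi => hs i (Finset.mem_range.1 hi)
  have hN0 : 0 < (N : ℝ) := by linarith
  have hN0' : 0 < N := by exact_mod_cast hN0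
  have hsN : ∀ i < n, s i ≤ N := fun i hi => by
    have := Finset.single_le_sum (f := s) (fun i hi => hs i (Finset.mem_range.1 hi))
      (Finset.mem_range.2 hi)
    linarith
  have hmem : ∀ i < n, ∀ r : ℕ, r ≤ N → s i * (r / N) ∈ Set.Icc (0 : ℝ) (s i) := by
    intro i hi r hr
    have hr' : (r : ℝ) / N ≤ 1 := (div_le_one hN0).2 (by exact_mod_cast hr)
    have := hs i hi
    exact ⟨by positivity, mul_le_of_le_one_right this hr'⟩
  let z : ℕ → X := fun k => ξ (k / N) (s (k / N) * ((k % N : ℕ) / N))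
  have hz : ∀ q r, r < N → z (N * q + r) = ξ q (s q * (r / N)) := by
    intro q r hr
    simp only [z]
    rw [Nat.mul_add_div hN0', Nat.div_eq_of_lt hr, Nat.mul_add_mod, Nat.mod_eq_of_lt hr, add_zero]
  have hz' : ∀ q < n, ∀ r, r < N → z (N * q + r + 1) = ξ q (s q * ((r + 1 : ℕ) / N)) := by
    intro q hq r hr
    rcases Nat.lt_or_ge (r + 1) N with h | h
    · exact hz q (r + 1) h
    · have h : r + 1 = N := by omega
      have := hz (q + 1) 0 hN0'
      rw [Nat.mul_add, mul_one, add_zero] at this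
      rw [add_assoc, h, this, div_self hN0.ne', mul_one, hc q hq]
      simp
  refine ⟨N * n, z, Nat.mul_pos hN0' hn, ?_, ?_, ?_, ?_⟩
  · simpa using hz 0 0 hN0'
  · simpa using hz n 0 hN0'
  · intro k hk
    have hq : k / N < n := Nat.div_lt_of_lt_mul hk
    have hr : k % N < N := Nat.mod_lt _ hN0'
    have h1 := hz (k / N) _ hr
    have h2 := hz' (k / N) hq _ hr
    rw [Nat.div_add_mod] at h1 h2
    rw [h1, h2, (hξ _ hq).2 _ (hmem _ hq _ hr.le) _ (hmem _ hq _ hr), abs_sub_comm]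
    have : s (k / N) * ((k % N + 1 : ℕ) / N) - s (k / N) * ((k % N : ℕ) / N)
        = s (k / N) / N := by
      push_cast
      ring
    rw [this, abs_of_nonneg (div_nonneg (hs _ hq) hN0.le)]
    exact (div_le_one hN0).2 (hsN _ hq)
  · intro k hk
    have hq : k / N < n := Nat.div_lt_of_lt_mul hk
    exact ⟨_, hq, _, hmem _ hq _ (Nat.mod_lt k hN0').le, rfl⟩

/-- A geodesic joining the images of the endpoints of a concatenation of geodesics under a
coarsely Lipschitz map into a polygon hyperbolic space stays close to the image of the
concatenation. -/
theorem exists_dist_le_of_coarseLipschitz {X X' : Type*} [MetricSpace X] [MetricSpace X']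
    (hX' : IsGeodesicSpace X') {δ : ℝ} (hδ : ∀ P : GeodesicPolygon X', P.Thin δ)
    (φ : X → X') {lam K : ℝ} (hlam : 0 ≤ lam)
    (hφ : ∀ x y : X, dist (φ x) (φ y) ≤ lam * dist x y + K)
    {n : ℕ} (hn : 1 ≤ n) (s : ℕ → ℝ) (ξ : ℕ → ℝ → X)
    (hξ : ∀ i < n, IsGeodesicOn (ξ i) (s i)) (hc : ∀ i < n, ξ i (s i) = ξ (i + 1) 0)
    {γ : ℝ → X'} {L : ℝ} (hγ : IsGeodesicOn γ L) (h0 : γ 0 = φ (ξ n 0)) (hL : γ L = φ (ξ 0 0))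
    {u : ℝ} (hu : u ∈ Set.Icc 0 L) :
    ∃ j < n, ∃ v ∈ Set.Icc (0 : ℝ) (s j), dist (γ u) (φ (ξ j v)) ≤ δ + (lam + K) := by
  obtain ⟨m, z, hm, hz0, hzm, hz, hzξ⟩ := exists_chain_of_geodesics hn s ξ hξ hc
  obtain ⟨k, hk, hd⟩ := exists_dist_le_of_chain hX' hδ (C := lam + K) hm (fun k => φ (z k))
    (fun k hk => (hφ _ _).trans (by nlinarith [hz k hk])) hγ (by simp [hzm, h0])
    (by simp [hz0, hL]) hu
  obtain ⟨j, hj, v, hv, h⟩ := hzξ k hk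
  exact ⟨j, hj, v, hv, by rwa [← h]⟩

/-- If an interval is the union of two sets containing its left and right endpoints respectively,
then the two sets have points at distance at most two. -/
theorem exists_near_of_cover {L : ℝ} (hL : 0 ≤ L) {A B : ℝ → Prop}
    (hA : A 0) (hB : B L) (hAB : ∀ u ∈ Set.Icc 0 L, A u ∨ B u) :
    ∃ u ∈ Set.Icc 0 L, ∃ v ∈ Set.Icc 0 L, A u ∧ B v ∧ |u - v| ≤ 2 := by
  let S : Set ℝ := {u | u ∈ Set.Icc 0 L ∧ A u}
  have hne : S.Nonempty := ⟨0, ⟨le_rfl, hL⟩, hA⟩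
  have hbdd : BddAbove S := ⟨L, fun u hu => hu.1.2⟩
  obtain ⟨u, hu, hlt⟩ := exists_lt_of_lt_csSup hne (sub_one_lt (sSup S))
  have hule := le_csSup hbdd hu
  rcases le_or_gt L (sSup S + 1) with h | h
  · exact ⟨u, hu.1, L, ⟨hL, le_rfl⟩, hu.2, hB,
      abs_le.2 ⟨by linarith, by linarith [hu.1.2]⟩⟩
  · have hv : sSup S + 1 ∈ Set.Icc 0 L := ⟨by linarith [hu.1.1], h.le⟩
    refine ⟨u, hu.1, _, hv, hu.2, (hAB _ hv).resolve_left fun hA' => ?_,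
      abs_le.2 ⟨by linarith, by linarith⟩⟩
    have := le_csSup hbdd (show sSup S + 1 ∈ S from ⟨hv, hA'⟩)
    linarith


/-- If `φ : X → X'` is a `(λ, K)`-quasi-isometric embedding between geodesic metric
spaces and `X'` is polygon hyperbolic, then `X` is polygon hyperbolic. -/
theorem polygonHyperbolic_of_qiEmbedding {X X' : Type*} [MetricSpace X] [MetricSpace X']
    (hX : IsGeodesicSpace X) (hX' : IsGeodesicSpace X')
    (φ : X → X') (lam K : ℝ) (hlam : 1 ≤ lam) (hK : 0 ≤ K)
    (hφ : ∀ x y : X, (1 / lam) * dist x y - K ≤ dist (φ x) (φ y) ∧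
      dist (φ x) (φ y) ≤ lam * dist x y + K)
    (h : PolygonHyperbolic X') : PolygonHyperbolic X := by
  obtain ⟨δ, hδ0, hδ⟩ := h
  have hlam0 : 0 < lam := by linarith
  have hlow : ∀ x y R, dist (φ x) (φ y) ≤ R → dist x y ≤ lam * (R + K) := by
    intro x y R hR
    have h1 := (hφ x y).1
    rw [one_div, ← div_eq_inv_mul] at h1
    have h2 : dist x y / lam ≤ R + K := by linarith
    rw [div_le_iff₀ hlam0] at h2
    linarith
  set D := δ + (lam + K) with hD
  have hD0 : 0 ≤ D := by positivity
  set E := lam * (2 * D + 2 + K) with hE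
  refine ⟨lam * ((lam * E + K) + 2 * D + K), by positivity, fun P t ht => ?_⟩
  have hPn := P.geodesic P.n le_rfl
  obtain ⟨L, γ, hγ, hγ0, hγL⟩ := hX' (φ (P.ξ P.n 0)) (φ (P.ξ P.n (P.s P.n)))
  have hnear : ∀ u ∈ Set.Icc 0 L, ∃ a ∈ Set.Icc 0 (P.s P.n), dist (γ u) (φ (P.ξ P.n a)) ≤ D := by
    intro u hu
    obtain ⟨j, hj, v, hv, hd⟩ := exists_dist_le_of_coarseLipschitz hX' hδ φ hlam0.le
      (fun x y => (hφ x y).2) le_rfl (fun _ => P.s P.n)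
      (fun i v => if i = 0 then P.ξ P.n (P.s P.n - v) else P.ξ P.n 0)
      (fun i hi => by simpa [Nat.lt_one_iff.1 hi] using hPn.reverse)
      (fun i hi => by simp [Nat.lt_one_iff.1 hi]) hγ (by simpa using hγ0) (by simpa using hγL) hu
    rw [if_pos (Nat.lt_one_iff.1 hj)] at hd
    exact ⟨_, ⟨by linarith [hv.2], by linarith [hv.1]⟩, hd⟩
  obtain ⟨u, hu, v, hv, ⟨a, ha, hat, hda⟩, ⟨b, hb, htb, hdb⟩, huv⟩ :=
    exists_near_of_cover hγ.1
      (A := fun u => ∃ a ∈ Set.Icc 0 (P.s P.n), a ≤ t ∧ dist (γ u) (φ (P.ξ P.n a)) ≤ D)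
      (B := fun u => ∃ b ∈ Set.Icc 0 (P.s P.n), t ≤ b ∧ dist (γ u) (φ (P.ξ P.n b)) ≤ D)
      ⟨0, ⟨le_rfl, hPn.1⟩, ht.1, by simpa [hγ0] using hD0⟩
      ⟨P.s P.n, ⟨hPn.1, le_rfl⟩, ht.2, by simpa [hγL] using hD0⟩
      (fun u hu => by
        obtain ⟨a, ha, hd⟩ := hnear u hu
        exact (le_total a t).imp (fun h => ⟨a, ha, h, hd⟩) (fun h => ⟨a, ha, h, hd⟩))
  have hab : dist (P.ξ P.n a) (P.ξ P.n b) ≤ E := by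
    refine hlow _ _ _ ?_
    have h1 := dist_triangle4 (φ (P.ξ P.n a)) (γ u) (γ v) (φ (P.ξ P.n b))
    rw [hγ.2 u hu v hv, dist_comm _ (γ u)] at h1
    linarith
  have hta : dist (P.ξ P.n t) (P.ξ P.n a) ≤ E := by
    rw [hPn.2 a ha b hb, abs_sub_comm, abs_of_nonneg (by linarith)] at hab
    rw [hPn.2 t ht a ha, abs_of_nonneg (by linarith)]
    linarith
  have htu : dist (φ (P.ξ P.n t)) (φ (P.ξ P.n a)) ≤ lam * E + K :=
    (hφ _ _).2.trans (by gcongr)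
  obtain ⟨j, hj, w, hw, hd⟩ := exists_dist_le_of_coarseLipschitz hX' hδ φ hlam0.le
    (fun x y => (hφ x y).2) P.one_le_n P.s P.ξ (fun i hi => P.geodesic i hi.le) P.chain hγ hγ0
    (by rw [hγL, P.closed]) hu
  refine ⟨j, hj, w, hw, hlow _ _ _ ?_⟩
  have h1 := dist_triangle4 (φ (P.ξ P.n t)) (φ (P.ξ P.n a)) (γ u) (φ (P.ξ j w))
  rw [dist_comm _ (γ u)] at h1
  linarith
end

section
/- Let X be a geodesic metric space and δ ≥ 0 such that every geodesic polygon in X is δ-thin. Then for every n ≥ 2 and all points x₀, x₁, …, xₙ, p ∈ X one has (x₀|xₙ)_p ≥ min{(x₀|x₁)_p, (x₁|x₂)_p, …, (xₙ₋₁|xₙ)_p} − 3δ. -/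
/-- The Gromov product `(x|y)_p = ½(d(p,x) + d(p,y) − d(x,y))`. -/
noncomputable def gromovProd {X : Type*} [MetricSpace X] (p x y : X) : ℝ :=
  (dist p x + dist p y - dist x y) / 2

theorem IsGeodesicOn.dist_endpoints {X : Type*} [MetricSpace X] {ξ : ℝ → X} {s : ℝ}
    (h : IsGeodesicOn ξ s) : dist (ξ 0) (ξ s) = s := by
  rw [h.2 0 ⟨le_rfl, h.1⟩ s ⟨h.1, le_rfl⟩, zero_sub, abs_neg, abs_of_nonneg h.1]

theorem IsGeodesicOn.dist_left {X : Type*} [MetricSpace X] {ξ : ℝ → X} {s u : ℝ}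
    (h : IsGeodesicOn ξ s) (hu : u ∈ Set.Icc 0 s) : dist (ξ 0) (ξ u) = u := by
  rw [h.2 0 ⟨le_rfl, h.1⟩ u hu, zero_sub, abs_neg, abs_of_nonneg hu.1]

theorem IsGeodesicOn.dist_right {X : Type*} [MetricSpace X] {ξ : ℝ → X} {s u : ℝ}
    (h : IsGeodesicOn ξ s) (hu : u ∈ Set.Icc 0 s) : dist (ξ u) (ξ s) = s - u := by
  rw [h.2 u hu s ⟨h.1, le_rfl⟩, abs_sub_comm, abs_of_nonneg (sub_nonneg.2 hu.2)]

/-- In a geodesic space with `δ`-thin polygons, every point of a geodesic closing up a chain of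
points is `δ`-close to a point lying metrically between two consecutive points of the chain. -/
theorem exists_between_near_of_polygon_thin {X : Type*} [MetricSpace X]
    (hX : IsGeodesicSpace X) {δ : ℝ} (hthin : ∀ P : GeodesicPolygon X, P.Thin δ)
    {n : ℕ} (hn : 1 ≤ n) (x : ℕ → X) {ξ : ℝ → X} {s : ℝ} (hξ : IsGeodesicOn ξ s)
    (h0 : ξ 0 = x n) (hs : ξ s = x 0) {t : ℝ} (ht : t ∈ Set.Icc 0 s) :
    ∃ j < n, ∃ r, dist (ξ t) r ≤ δ ∧
      dist (x j) r + dist r (x (j + 1)) = dist (x j) (x (j + 1)) := by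
  choose σ γ hγ hγ0 hγs using hX
  let P : GeodesicPolygon X :=
    { n := n
      one_le_n := hn
      s := fun i => if i < n then σ (x i) (x (i + 1)) else s
      ξ := fun i => if i < n then γ (x i) (x (i + 1)) else ξ
      geodesic := fun i _ => by
        by_cases hi : i < n
        · simpa [hi] using hγ _ _
        · simpa [hi] using hξ
      chain := fun i hi => by
        by_cases hi' : i + 1 < n
        · simp [hi, hi', hγ0, hγs]
        · obtain rfl : i + 1 = n := by omega
          simp [h0, hγs]
      closed := by simp [Nat.pos_of_ne_zero (Nat.one_le_iff_ne_zero.1 hn), hγ0, hs] }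
  obtain ⟨j, hj, u, hu, hd⟩ := hthin P t (by simpa [P] using ht)
  replace hj : j < n := hj
  simp only [P, hj, lt_irrefl, if_true, if_false] at hu hd
  refine ⟨j, hj, _, hd, ?_⟩
  have hg := hγ (x j) (x (j + 1))
  have h₁ := hg.dist_left hu
  have h₂ := hg.dist_right hu
  have h₃ := hg.dist_endpoints
  rw [hγ0] at h₁ h₃
  rw [hγs] at h₂ h₃
  linarith

theorem gromovProd_le_dist_of_between {X : Type*} [MetricSpace X] (p : X) {x y r : X}
    (h : dist x r + dist r y = dist x y) : gromovProd p x y ≤ dist p r := by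
  have h₁ := dist_triangle p r x
  have h₂ := dist_triangle p r y
  rw [dist_comm r x] at h₁
  unfold gromovProd
  linarith

/-- In a geodesic space with `δ`-thin polygons, every geodesic from `y` to `x` contains a point
at distance at most `(x|y)_p + 2δ` from `p`. -/
theorem exists_dist_le_gromovProd_add {X : Type*} [MetricSpace X]
    (hX : IsGeodesicSpace X) {δ : ℝ} (hthin : ∀ P : GeodesicPolygon X, P.Thin δ)
    (p : X) {x y : X} {ξ : ℝ → X} {s : ℝ} (hξ : IsGeodesicOn ξ s)
    (h0 : ξ 0 = y) (hs : ξ s = x) :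
    ∃ t ∈ Set.Icc 0 s, dist p (ξ t) ≤ gromovProd p x y + 2 * δ := by
  have hlen := hξ.dist_endpoints
  rw [h0, hs] at hlen
  have hp₁ := dist_triangle p x y
  have hp₂ := dist_triangle p y x
  rw [dist_comm x y] at hp₁
  -- the point of `[y, x]` whose distance to `y` is `(p|x)_y`
  have ht : (s + dist p y - dist p x) / 2 ∈ Set.Icc 0 s := by constructor <;> linarith
  refine ⟨_, ht, ?_⟩
  have hl := hξ.dist_left ht
  have hr := hξ.dist_right ht
  rw [h0] at hl
  rw [hs] at hr
  obtain ⟨j, hj, r, hqr, hbet⟩ := exists_between_near_of_polygon_thin hX hthin one_le_two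
    (fun i => if i = 0 then x else if i = 1 then p else y) hξ (by simpa using h0)
    (by simpa using hs) ht
  set q := ξ ((s + dist p y - dist p x) / 2)
  have hpq := dist_triangle p r q
  have hxq := dist_triangle x r q
  have hyq := dist_triangle y r q
  simp only [dist_comm r q, dist_comm q x, dist_comm y x] at *
  unfold gromovProd
  interval_cases j
  · simp only [zero_add, if_true, one_ne_zero, if_false] at hbet
    simp only [dist_comm r p, dist_comm x p] at hbet
    linarith
  · norm_num at hbet
    simp only [dist_comm r y] at hbet
    linarith

/-- If every geodesic polygon in the geodesic metric space `X` is `δ`-thin, then for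
all `n ≥ 2` and all `x₀, …, xₙ, p ∈ X` one has
`(x₀|xₙ)_p ≥ min{(x₀|x₁)_p, …, (xₙ₋₁|xₙ)_p} − 3δ`. -/
theorem gromov_inequality_of_polygon_thin {X : Type*} [MetricSpace X]
    (hX : IsGeodesicSpace X) (δ : ℝ) (hδ : 0 ≤ δ)
    (hthin : ∀ P : GeodesicPolygon X, P.Thin δ) :
    ∀ (n : ℕ), ∀ _hn : 2 ≤ n, ∀ (x : ℕ → X) (p : X),
      ((Finset.range n).inf' (Finset.nonempty_range_iff.mpr (by omega))
          fun i => gromovProd p (x i) (x (i + 1))) - 3 * δ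
        ≤ gromovProd p (x 0) (x n) := by
  intro n hn x p
  obtain ⟨s, ξ, hξ, h0, hs⟩ := hX (x n) (x 0)
  obtain ⟨t, ht, hpq⟩ := exists_dist_le_gromovProd_add hX hthin p hξ h0 hs
  obtain ⟨j, hj, r, hqr, hbet⟩ :=
    exists_between_near_of_polygon_thin hX hthin (by omega) x hξ h0 hs ht
  have hmin := Finset.inf'_le (fun i => gromovProd p (x i) (x (i + 1))) (Finset.mem_range.2 hj)
  have hj' := gromovProd_le_dist_of_between p hbet
  have htri := dist_triangle p (ξ t) r
  linarith
end

section
/- Let X be a geodesic metric space and δ ≥ 0 such that every geodesic polygon in X is δ-thin. Then for every geodesic ξ in X and every coterminal continuous path ξ' (a continuous path with the same endpoints as ξ), the image of ξ is contained in the closed (δ+1)-neighborhood of the image of ξ'. -/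
/-- `ξ` is a (continuous) path defined on the interval `[0, s]`. -/
def IsPathOn {X : Type*} [MetricSpace X] (ξ : ℝ → X) (s : ℝ) : Prop :=
  0 ≤ s ∧ ContinuousOn ξ (Set.Icc (0:ℝ) s)

/-- Points of a geodesic are no farther from its initial point than its final point is. -/
theorem IsGeodesicOn.dist_initial_le {X : Type*} [MetricSpace X] {ξ : ℝ → X} {s u : ℝ}
    (hξ : IsGeodesicOn ξ s) (hu : u ∈ Set.Icc (0:ℝ) s) :
    dist (ξ u) (ξ 0) ≤ dist (ξ 0) (ξ s) := by
  have h0 : (0:ℝ) ∈ Set.Icc (0:ℝ) s := ⟨le_rfl, hξ.1⟩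
  rw [hξ.2 u hu 0 h0, hξ.2 0 h0 s ⟨hξ.1, le_rfl⟩, sub_zero, zero_sub, abs_neg,
    abs_of_nonneg hu.1, abs_of_nonneg hξ.1]
  exact hu.2

/-- A path, run backwards, can be subdivided by finitely many parameters into pieces whose
endpoints are at most `ε` apart. -/
theorem IsPathOn.exists_partition {X : Type*} [MetricSpace X] {ξ : ℝ → X} {s ε : ℝ}
    (hξ : IsPathOn ξ s) (hε : 0 < ε) :
    ∃ n : ℕ, 1 ≤ n ∧ ∃ τ : ℕ → ℝ, (∀ i ≤ n, τ i ∈ Set.Icc (0:ℝ) s) ∧ τ 0 = s ∧ τ n = 0 ∧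
      ∀ i < n, dist (ξ (τ i)) (ξ (τ (i + 1))) ≤ ε := by
  obtain ⟨hs, hcont⟩ := hξ
  obtain ⟨η, hη, hclose⟩ := Metric.uniformContinuousOn_iff.1
    (isCompact_Icc.uniformContinuousOn_of_continuous hcont) ε hε
  obtain ⟨m, hm⟩ := exists_nat_gt (s / η)
  have hn : (0:ℝ) < (m + 1 : ℕ) := by positivity
  have hmem : ∀ i ≤ m + 1, s * (1 - i / (m + 1 : ℕ)) ∈ Set.Icc (0:ℝ) s := by
    intro i hi
    have h1 : (i : ℝ) / (m + 1 : ℕ) ≤ 1 := (div_le_one hn).2 (by exact_mod_cast hi)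
    have h2 : (0:ℝ) ≤ (i : ℝ) / (m + 1 : ℕ) := by positivity
    exact ⟨mul_nonneg hs (by linarith), mul_le_of_le_one_right hs (by linarith)⟩
  refine ⟨m + 1, by omega, fun i => s * (1 - i / (m + 1 : ℕ)), hmem, by simp, ?_, ?_⟩
  · beta_reduce
    rw [div_self hn.ne', sub_self, mul_zero]
  · intro i hi
    refine (hclose _ (hmem i hi.le) _ (hmem (i + 1) hi) ?_).le
    have hstep : s * (1 - i / (m + 1 : ℕ)) - s * (1 - (i + 1 : ℕ) / (m + 1 : ℕ)) =
        s / (m + 1 : ℕ) := by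
      push_cast
      ring
    rw [Real.dist_eq, hstep, abs_of_nonneg (div_nonneg hs hn.le), div_lt_comm₀ hn hη]
    push_cast
    linarith

/-- If every geodesic polygon in the geodesic metric space `X` is `δ`-thin, then
every geodesic lies in the closed `(δ+1)`-neighbourhood of any coterminal
continuous path. -/
theorem geodesic_near_coterminal_path_of_polygon_thin {X : Type*} [MetricSpace X]
    (hX : IsGeodesicSpace X) (δ : ℝ) (hδ : 0 ≤ δ)
    (hthin : ∀ P : GeodesicPolygon X, P.Thin δ) :
    ∀ (s s' : ℝ) (ξ ξ' : ℝ → X), IsGeodesicOn ξ s → IsPathOn ξ' s' →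
      ξ' 0 = ξ 0 → ξ' s' = ξ s →
      ∀ t ∈ Set.Icc (0:ℝ) s, ∃ u ∈ Set.Icc (0:ℝ) s', dist (ξ t) (ξ' u) ≤ δ + 1 := by
  intro s s' ξ ξ' hξ hξ' h0 hs t ht
  obtain ⟨n, hn, τ, hτ, hτ0, hτn, hclose⟩ := hξ'.exists_partition zero_lt_one
  choose ℓ γ hγ hγ0 hγℓ using fun i : ℕ => hX (ξ' (τ i)) (ξ' (τ (i + 1)))
  let P : GeodesicPolygon X :=
    { n := n
      one_le_n := hn
      s := fun i => if i < n then ℓ i else s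
      ξ := fun i => if i < n then γ i else ξ
      geodesic := fun i _ => by
        by_cases h : i < n
        · simpa [h] using hγ i
        · simpa [h] using hξ
      chain := fun i hi => by
        rcases (Nat.succ_le_of_lt hi).lt_or_eq with h | h
        · simp [hi, show i + 1 < n from h, hγℓ, hγ0]
        · have h' : i + 1 = n := h
          simp [hi, h', hγℓ, hτn, h0]
      closed := by
        have h : 0 < n := hn
        simp [h, hγ0, hτ0, hs] }
  obtain ⟨j, hj, u, hu, hdist⟩ := hthin P t (by simpa [P] using ht)
  have hj' : j < n := hj
  simp only [P, hj', lt_irrefl, if_true, if_false] at hu hdist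
  refine ⟨τ j, hτ j hj'.le, ?_⟩
  have hstart : dist (γ j u) (ξ' (τ j)) ≤ 1 := by
    rw [← hγ0 j]
    refine ((hγ j).dist_initial_le hu).trans ?_
    rw [hγ0, hγℓ]
    exact hclose j hj'
  exact (dist_triangle _ _ _).trans (add_le_add hdist hstart)
end

section
/- Let X be a geodesic metric space with mesh(X) = μ < +∞. Then every geodesic polygon in X is (3μ+1)/2-thin. -/
/-- A triangle `[[ξ₀, ξ₁, ξ₂]]`: a closed cycle of three continuous paths. -/
structure Triangle (X : Type*) [MetricSpace X] where
  s : Fin 3 → ℝ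
  ξ : Fin 3 → ℝ → X
  path : ∀ i, IsPathOn (ξ i) (s i)
  chain : ∀ i : Fin 3, ξ i (s i) = ξ (i + 1) 0

/-- The mesh of a triangle: the infimum, over choices of a point on each side, of the
diameter of the resulting three-point set. -/
noncomputable def Triangle.mesh {X : Type*} [MetricSpace X] (T : Triangle X) : ℝ :=
  sInf { d : ℝ | ∃ u : Fin 3 → ℝ, (∀ i, u i ∈ Set.Icc (0:ℝ) (T.s i)) ∧
    d = Metric.diam (Set.range fun i => T.ξ i (u i)) }

/-- The mesh of the space `X`: the supremum of the meshes of all triangles in `X`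
(as an extended nonnegative real, so that it may be `+∞`). -/
noncomputable def meshSpace (X : Type*) [MetricSpace X] : ENNReal :=
  ⨆ T : Triangle X, ENNReal.ofReal T.mesh

theorem IsGeodesicOn.continuousOn {X : Type*} [MetricSpace X] {ξ : ℝ → X} {s : ℝ}
    (h : IsGeodesicOn ξ s) : ContinuousOn ξ (Set.Icc (0:ℝ) s) := by
  have hL : LipschitzOnWith 1 ξ (Set.Icc (0:ℝ) s) :=
    LipschitzOnWith.of_dist_le_mul fun a ha b hb => by
      rw [h.2 a ha b hb, Real.dist_eq, NNReal.coe_one, one_mul]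
  exact hL.continuousOn

/-- Two paths with a common endpoint can be concatenated, without enlarging the union of
their images. -/
theorem IsPathOn.exists_concat {X : Type*} [MetricSpace X] {γ η : ℝ → X} {a b : ℝ}
    (hγ : IsPathOn γ a) (hη : IsPathOn η b) (h : γ a = η 0) :
    ∃ ζ : ℝ → X, IsPathOn ζ (a + b) ∧ ζ 0 = γ 0 ∧ ζ (a + b) = η b ∧
      ∀ v ∈ Set.Icc (0:ℝ) (a + b),
        (∃ u ∈ Set.Icc (0:ℝ) a, ζ v = γ u) ∨ ∃ u ∈ Set.Icc (0:ℝ) b, ζ v = η u := by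
  have ha := hγ.1
  have hb := hη.1
  have left : ∀ v ≤ a, (if v ≤ a then γ v else η (v - a)) = γ v := fun v hv => if_pos hv
  have right : ∀ v, a ≤ v → (if v ≤ a then γ v else η (v - a)) = η (v - a) := by
    intro v hv
    split_ifs with h'
    · obtain rfl := le_antisymm h' hv
      rw [h, sub_self]
    · rfl
  refine ⟨fun v => if v ≤ a then γ v else η (v - a), ⟨by linarith, ?_⟩, left 0 ha, ?_, ?_⟩
  · rw [← Set.Icc_union_Icc_eq_Icc ha (by linarith : a ≤ a + b)]
    refine ContinuousOn.union_of_isClosed ?_ ?_ isClosed_Icc isClosed_Icc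
    · exact hγ.2.congr fun v hv => left v hv.2
    · refine ContinuousOn.congr (f := fun v => η (v - a)) ?_ fun v hv => right v hv.1
      exact hη.2.comp (by fun_prop) fun v hv => ⟨by linarith [hv.1], by linarith [hv.2]⟩
  · exact (right _ (by linarith)).trans (by rw [add_sub_cancel_left])
  · intro v hv
    rcases le_total v a with h' | h'
    · exact Or.inl ⟨v, ⟨hv.1, h'⟩, left v h'⟩
    · exact Or.inr ⟨v - a, ⟨by linarith, by linarith [hv.2]⟩, right v h'⟩

/-- The first `k + 1` sides of a geodesic polygon form a path. -/
theorem GeodesicPolygon.exists_path {X : Type*} [MetricSpace X] (P : GeodesicPolygon X)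
    (k : ℕ) (hk : k ≤ P.n) :
    ∃ (l : ℝ) (γ : ℝ → X), IsPathOn γ l ∧ γ 0 = P.ξ 0 0 ∧ γ l = P.ξ k (P.s k) ∧
      ∀ v ∈ Set.Icc (0:ℝ) l, ∃ j ≤ k, ∃ u ∈ Set.Icc (0:ℝ) (P.s j), γ v = P.ξ j u := by
  induction k with
  | zero =>
    have h := P.geodesic 0 hk
    exact ⟨P.s 0, P.ξ 0, ⟨h.1, h.continuousOn⟩, rfl, rfl, fun v hv => ⟨0, le_rfl, v, hv, rfl⟩⟩
  | succ k ih =>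
    obtain ⟨l, γ, hγ, h0, hl, him⟩ := ih (by omega)
    have h := P.geodesic (k + 1) hk
    obtain ⟨ζ, hζ, hζ0, hζl, hζim⟩ :=
      hγ.exists_concat ⟨h.1, h.continuousOn⟩ (hl.trans (P.chain k (by omega)))
    refine ⟨_, ζ, hζ, hζ0.trans h0, hζl, fun v hv => ?_⟩
    rcases hζim v hv with ⟨u, hu, e⟩ | ⟨u, hu, e⟩
    · obtain ⟨j, hj, w, hw, e'⟩ := him u hu
      exact ⟨j, by omega, w, hw, e.trans e'⟩
    · exact ⟨k + 1, le_rfl, u, hu, e⟩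

theorem Triangle.mesh_le {X : Type*} [MetricSpace X] {μ : ℝ} (hμ : 0 ≤ μ)
    (hmesh : meshSpace X ≤ ENNReal.ofReal μ) (T : Triangle X) : T.mesh ≤ μ :=
  (ENNReal.ofReal_le_ofReal_iff hμ).1
    ((le_iSup (fun T : Triangle X => ENNReal.ofReal T.mesh) T).trans hmesh)

theorem Triangle.exists_dist_lt {X : Type*} [MetricSpace X] (T : Triangle X) {r : ℝ}
    (hr : T.mesh < r) :
    ∃ u : Fin 3 → ℝ, (∀ i, u i ∈ Set.Icc (0:ℝ) (T.s i)) ∧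
      ∀ i j, dist (T.ξ i (u i)) (T.ξ j (u j)) < r := by
  obtain ⟨_, ⟨u, hu, rfl⟩, hd⟩ := exists_lt_of_csInf_lt
    (by exact ⟨_, fun _ => 0, fun i => ⟨le_rfl, (T.path i).1⟩, rfl⟩) hr
  refine ⟨u, hu, fun i j => (Metric.dist_le_diam_of_mem ?_ ?_ ?_).trans_lt hd⟩
  · exact (Set.finite_range _).isBounded
  · exact ⟨i, rfl⟩
  · exact ⟨j, rfl⟩

/-- If the geodesic metric space `X` satisfies `mesh(X) = μ < +∞`, then every geodesic
polygon in `X` is `(3μ+1)/2`-thin. -/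
theorem polygon_thin_of_meshSpace_eq {X : Type*} [MetricSpace X]
    (hX : IsGeodesicSpace X) (μ : ℝ) (hμ : 0 ≤ μ)
    (hmesh : meshSpace X = ENNReal.ofReal μ) :
    ∀ P : GeodesicPolygon X, P.Thin ((3 * μ + 1) / 2) := by
  intro P t ht
  obtain ⟨m, hm⟩ : ∃ m, P.n = m + 1 := ⟨P.n - 1, by have := P.one_le_n; omega⟩
  obtain ⟨l, α, hα, hα0, hαl, him⟩ := P.exists_path m (by omega)
  have hg := P.geodesic P.n le_rfl
  have hc := hg.continuousOn
  have hend : α l = P.ξ P.n 0 := by rw [hαl, P.chain m (by omega), hm]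
  let T : Triangle X :=
    { s := ![t, P.s P.n - t, l]
      ξ := ![P.ξ P.n, fun v => P.ξ P.n (t + v), α]
      path := by
        intro i
        fin_cases i
        · exact ⟨ht.1, hc.mono (Set.Icc_subset_Icc_right ht.2)⟩
        · exact ⟨sub_nonneg.2 ht.2, hc.comp (by fun_prop) fun v hv =>
            ⟨add_nonneg ht.1 hv.1, le_sub_iff_add_le'.1 hv.2⟩⟩
        · exact hα
      chain := by
        intro i
        fin_cases i
        · simp
        · simp [hα0, P.closed]
        · simpa using hend }
  obtain ⟨u, hu, hd⟩ := T.exists_dist_lt (r := μ + 1 / 3)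
    ((T.mesh_le hμ hmesh.le).trans_lt (by linarith))
  have h0 : u 0 ∈ Set.Icc (0:ℝ) t := hu 0
  have h1 : u 1 ∈ Set.Icc (0:ℝ) (P.s P.n - t) := hu 1
  obtain ⟨j, hj, w, hw, hαw⟩ := him (u 2) (hu 2)
  refine ⟨j, by omega, w, hw, ?_⟩
  rw [← hαw]
  have m0 : u 0 ∈ Set.Icc (0:ℝ) (P.s P.n) := ⟨h0.1, h0.2.trans ht.2⟩
  have m1 : t + u 1 ∈ Set.Icc (0:ℝ) (P.s P.n) :=
    ⟨add_nonneg ht.1 h1.1, by linarith [h1.2]⟩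
  have d01 : dist (P.ξ P.n (u 0)) (P.ξ P.n (t + u 1)) < μ + 1 / 3 := hd 0 1
  have d02 : dist (P.ξ P.n (u 0)) (α (u 2)) < μ + 1 / 3 := hd 0 2
  have d12 : dist (P.ξ P.n (t + u 1)) (α (u 2)) < μ + 1 / 3 := hd 1 2
  have e0 := hg.2 t ht _ m0
  have e1 := hg.2 t ht _ m1
  rw [hg.2 _ m0 _ m1, abs_sub_comm, abs_of_nonneg (by linarith [h0.2, h1.1])] at d01
  rw [abs_of_nonneg (by linarith [h0.2])] at e0
  rw [abs_sub_comm, abs_of_nonneg (by linarith [h1.1])] at e1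
  have t0 := dist_triangle (P.ξ P.n t) (P.ξ P.n (u 0)) (α (u 2))
  have t1 := dist_triangle (P.ξ P.n t) (P.ξ P.n (t + u 1)) (α (u 2))
  linarith
end

section
/- The hyperbolic plane (the upper half-plane with its hyperbolic metric) is not polygon hyperbolic: for every δ ≥ 0 there exists a geodesic polygon in the hyperbolic plane that is not δ-thin. -/
/-- The arc of the semicircle with centre `c` and radius `cosh T` between its two points at
height `1`, parametrized on `[0, 2 * T]` by arc length. It runs from left to right for `e = 1`
and from right to left for `e = -1`. -/
noncomputable def semicircleArc (e c T t : ℝ) : UpperHalfPlane :=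
  ⟨⟨c + e * (Real.cosh T * (Real.sinh (t - T) / Real.cosh (t - T))),
    Real.cosh T / Real.cosh (t - T)⟩, div_pos (Real.cosh_pos _) (Real.cosh_pos _)⟩

theorem semicircleArc_re (e c T t : ℝ) : (semicircleArc e c T t).re =
    c + e * (Real.cosh T * (Real.sinh (t - T) / Real.cosh (t - T))) := rfl

theorem semicircleArc_im (e c T t : ℝ) :
    (semicircleArc e c T t).im = Real.cosh T / Real.cosh (t - T) := rfl

theorem dist_semicircleArc {e : ℝ} (he : e ^ 2 = 1) (c T a b : ℝ) :
    dist (semicircleArc e c T a) (semicircleArc e c T b) = |a - b| := by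
  have h : Real.cosh (dist (semicircleArc e c T a) (semicircleArc e c T b)) =
      Real.cosh |a - b| := by
    rw [UpperHalfPlane.cosh_dist', Real.cosh_abs, show a - b = (a - T) - (b - T) by ring,
      Real.cosh_sub]
    simp only [semicircleArc_re, semicircleArc_im]
    have hr := (Real.cosh_pos T).ne'
    have ha := (Real.cosh_pos (a - T)).ne'
    have hb := (Real.cosh_pos (b - T)).ne'
    have hA := Real.cosh_sq (a - T)
    have hB := Real.cosh_sq (b - T)
    generalize Real.cosh (a - T) = A at *
    generalize Real.cosh (b - T) = B at *
    generalize Real.sinh (a - T) = p at *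
    generalize Real.sinh (b - T) = q at *
    generalize Real.cosh T = r at *
    field_simp
    linear_combination r ^ 2 * ((p * B - A * q) ^ 2 * he - B ^ 2 * hA - A ^ 2 * hB)
  exact Real.cosh_strictMonoOn.injOn dist_nonneg (abs_nonneg (a - b)) h

theorem isGeodesicOn_semicircleArc {e : ℝ} (he : e ^ 2 = 1) (c : ℝ) {T : ℝ} (hT : 0 ≤ T) :
    IsGeodesicOn (semicircleArc e c T) (2 * T) :=
  ⟨by positivity, fun a _ b _ => dist_semicircleArc he c T a b⟩

theorem semicircleArc_start (e c T : ℝ) :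
    semicircleArc e c T 0 = ⟨⟨c - e * Real.sinh T, 1⟩, one_pos⟩ := by
  have h := (Real.cosh_pos T).ne'
  apply UpperHalfPlane.ext_re_im
  · rw [semicircleArc_re]
    simp only [zero_sub, Real.sinh_neg, Real.cosh_neg, UpperHalfPlane.mk_re]
    field_simp
    ring
  · rw [semicircleArc_im]
    simp [h]

theorem semicircleArc_end (e c T : ℝ) :
    semicircleArc e c T (2 * T) = ⟨⟨c + e * Real.sinh T, 1⟩, one_pos⟩ := by
  have h := (Real.cosh_pos T).ne'
  have h2 : 2 * T - T = T := by ring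
  apply UpperHalfPlane.ext_re_im
  · rw [semicircleArc_re, h2]
    simp only [UpperHalfPlane.mk_re]
    field_simp
  · rw [semicircleArc_im, h2]
    simp [h]

theorem semicircleArc_im_le (e c T t : ℝ) : (semicircleArc e c T t).im ≤ Real.cosh T :=
  div_le_self (Real.cosh_pos T).le (Real.one_le_cosh _)

theorem semicircleArc_self_im (e c T : ℝ) : (semicircleArc e c T T).im = Real.cosh T := by
  simp [semicircleArc_im]

/-- The polygon inscribed in the horocycle of height `1` with `n` short sides of length `2`,
running from right to left, and one long side, running back from left to right. -/
noncomputable def horocyclicPolygon (n : ℕ) (hn : 1 ≤ n) : GeodesicPolygon UpperHalfPlane where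
  n := n
  one_le_n := hn
  s k := if k < n then 2 * 1 else 2 * Real.arsinh (n * Real.sinh 1)
  ξ k := if k < n then semicircleArc (-1) ((n - 1 - 2 * k) * Real.sinh 1) 1
    else semicircleArc 1 0 (Real.arsinh (n * Real.sinh 1))
  geodesic k _ := by
    split_ifs
    · exact isGeodesicOn_semicircleArc (by norm_num) _ zero_le_one
    · refine isGeodesicOn_semicircleArc (by norm_num) _ (Real.arsinh_nonneg_iff.2 ?_)
      have := Real.sinh_pos_iff.2 one_pos
      positivity
  chain k hk := by
    rw [if_pos hk, if_pos hk, semicircleArc_end]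
    split_ifs with h
    · rw [semicircleArc_start]
      congr 2
      push_cast
      ring
    · obtain rfl : n = k + 1 := by omega
      rw [semicircleArc_start, Real.sinh_arsinh]
      congr 2
      push_cast
      ring
  closed := by
    rw [if_neg (lt_irrefl n), if_neg (lt_irrefl n), if_pos (by omega), semicircleArc_end,
      semicircleArc_start, Real.sinh_arsinh]
    congr 2
    push_cast
    ring

theorem horocyclicPolygon_not_thin {n : ℕ} (hn : 1 ≤ n) {δ : ℝ}
    (h : Real.cosh 1 * Real.exp δ < n) : ¬ (horocyclicPolygon n hn).Thin δ := by
  intro hthin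
  have h1 : (1 : ℝ) ≤ Real.sinh 1 := Real.self_le_sinh_iff.2 zero_le_one
  have hT : 0 ≤ Real.arsinh (n * Real.sinh 1) := Real.arsinh_nonneg_iff.2 (by positivity)
  obtain ⟨j, hj, u, -, hu⟩ := hthin (Real.arsinh (n * Real.sinh 1))
    ⟨hT, by simp only [horocyclicPolygon, lt_irrefl, if_false]; linarith⟩
  change j < n at hj
  simp only [horocyclicPolygon, lt_irrefl, if_false, if_pos hj] at hu
  have him := UpperHalfPlane.im_le_im_mul_exp_dist
    (semicircleArc 1 0 (Real.arsinh (n * Real.sinh 1)) (Real.arsinh (n * Real.sinh 1)))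
    (semicircleArc (-1) ((n - 1 - 2 * j) * Real.sinh 1) 1 u)
  rw [semicircleArc_self_im] at him
  have hlow := Real.sinh_lt_cosh (Real.arsinh (n * Real.sinh 1))
  rw [Real.sinh_arsinh] at hlow
  have hn1 : (n : ℝ) ≤ n * Real.sinh 1 := le_mul_of_one_le_right (Nat.cast_nonneg n) h1
  have hup := mul_le_mul (semicircleArc_im_le (-1) ((n - 1 - 2 * j) * Real.sinh 1) 1 u)
    (Real.exp_le_exp.2 hu) (Real.exp_pos _).le (Real.cosh_pos 1).le
  linarith

/-- The hyperbolic plane (the upper half-plane with its hyperbolic metric) is not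
polygon hyperbolic: for every `δ ≥ 0` there is a geodesic polygon which is not
`δ`-thin. -/
theorem upperHalfPlane_not_polygonHyperbolic :
    ¬ PolygonHyperbolic UpperHalfPlane ∧
      ∀ δ : ℝ, 0 ≤ δ → ∃ P : GeodesicPolygon UpperHalfPlane, ¬ P.Thin δ := by
  have key : ∀ δ : ℝ, 0 ≤ δ → ∃ P : GeodesicPolygon UpperHalfPlane, ¬ P.Thin δ := by
    intro δ _
    obtain ⟨n, hn⟩ := exists_nat_gt (Real.cosh 1 * Real.exp δ)
    have hpos : (0 : ℝ) < n := lt_trans (by positivity) hn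
    exact ⟨horocyclicPolygon n (Nat.cast_pos.1 hpos), horocyclicPolygon_not_thin _ hn⟩
  refine ⟨?_, key⟩
  rintro ⟨δ, hδ, h⟩
  obtain ⟨P, hP⟩ := key δ hδ
  exact hP (h P)
end
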